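/- For all natural numbers p and q there is an isomorphism of ℝ-algebras Cl(p,q) ⊗_ℝ Cl(0,2) ≅ Cl(q, p+2). -/

import Mathlib

open TensorProduct

/-- The quadratic form on ℝ^{p+q} with `p` plus signs and `q` minus signs. -/
noncomputable def Qpq (p q : ℕ) : QuadraticForm ℝ (Fin (p + q) → ℝ) :=
  QuadraticMap.weightedSumSquares ℝ (fun i : Fin (p + q) => if (i : ℕ) < p then (1 : ℝ) else -1)

/-- The real Clifford algebra `Cl(p,q)`. -/
noncomputable def Cl (p q : ℕ) : Type :=
  CliffordAlgebra (Qpq p q)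

noncomputable instance (p q : ℕ) : Ring (Cl p q) :=
  inferInstanceAs (Ring (CliffordAlgebra (Qpq p q)))

noncomputable instance (p q : ℕ) : Algebra ℝ (Cl p q) :=
  inferInstanceAs (Algebra ℝ (CliffordAlgebra (Qpq p q)))

namespace CliffordAlgebra

variable {R M N A : Type*} [CommRing R] [AddCommGroup M] [Module R M] [AddCommGroup N]
  [Module R N] [Ring A] [Algebra R A] {Q : QuadraticForm R M} {P : QuadraticForm R N} {a b : N}

theorem ι_mul_ι_mul_self_of_isOrtho (hab : P.IsOrtho a b) (ha : P a = -1) (hb : P b = -1) :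
    (ι P a * ι P b) * (ι P a * ι P b) = -1 := by
  have h1 := ι_sq_scalar P a
  have h2 := ι_sq_scalar P b
  rw [ha, map_neg, map_one] at h1
  rw [hb, map_neg, map_one] at h2
  calc (ι P a * ι P b) * (ι P a * ι P b) = (ι P a * ι P b) * (-(ι P b * ι P a)) := by
        rw [← ι_mul_ι_comm_of_isOrtho hab]
    _ = -(ι P a * (ι P b * ι P b) * ι P a) := by noncomm_ring
    _ = -1 := by rw [h2]; simp [h1]

theorem ι_mul_ι_mul_ι_comm_of_isOrtho {x : N} (hxa : P.IsOrtho x a) (hxb : P.IsOrtho x b) :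
    (ι P a * ι P b) * ι P x = ι P x * (ι P a * ι P b) := by
  rw [mul_assoc, ι_mul_ι_comm_of_isOrtho hxb.symm, mul_neg, ← mul_assoc,
    ι_mul_ι_comm_of_isOrtho hxa.symm, neg_mul, neg_neg, mul_assoc]

theorem ι_mul_ι_mul_ι_anticomm (hab : P.IsOrtho a b) (hspan : Submodule.span R {a, b} = ⊤)
    (u : N) : (ι P a * ι P b) * ι P u = -(ι P u * (ι P a * ι P b)) := by
  have h := ι_mul_ι_comm_of_isOrtho hab.symm
  have hu : u ∈ Submodule.span R {a, b} := hspan ▸ Submodule.mem_top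
  obtain ⟨r, s, rfl⟩ := Submodule.mem_span_pair.1 hu
  have h1 : (ι P a * ι P b) * ι P a = -(ι P a * (ι P a * ι P b)) := by
    rw [mul_assoc, h, mul_neg]
  have h2 : (ι P a * ι P b) * ι P b = -(ι P b * (ι P a * ι P b)) := by
    rw [← mul_assoc (ι P b), h, neg_mul, neg_neg]
  simp only [map_add, map_smul, mul_add, add_mul, mul_smul_comm, smul_mul_assoc, h1, h2,
    smul_neg, neg_add]

theorem commute_of_commute_ι (f : CliffordAlgebra Q →ₐ[R] A) (g : CliffordAlgebra P →ₐ[R] A)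
    (h : ∀ m n, Commute (f (ι Q m)) (g (ι P n))) (x : CliffordAlgebra Q)
    (y : CliffordAlgebra P) : Commute (f x) (g y) := by
  induction x using CliffordAlgebra.induction with
  | algebraMap r => rw [AlgHom.commutes]; exact Algebra.commute_algebraMap_left _ _
  | mul x₁ x₂ h₁ h₂ => rw [map_mul]; exact h₁.mul_left h₂
  | add x₁ x₂ h₁ h₂ => rw [map_add]; exact h₁.add_left h₂
  | ι m =>
    induction y using CliffordAlgebra.induction with
    | algebraMap r => rw [AlgHom.commutes]; exact Algebra.commute_algebraMap_right _ _
    | mul y₁ y₂ h₁ h₂ => rw [map_mul]; exact h₁.mul_right h₂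
    | add y₁ y₂ h₁ h₂ => rw [map_add]; exact h₁.add_right h₂
    | ι n => exact h m n

variable (Q) in
/-- The map `Cl(-Q ⊕ P) → Cl(Q) ⊗ Cl(P)` sending `(m, u)` to `m ⊗ ab + 1 ⊗ u`. -/
noncomputable def negProdToTensor (hab : P.IsOrtho a b) (ha : P a = -1) (hb : P b = -1)
    (hspan : Submodule.span R {a, b} = ⊤) :
    CliffordAlgebra ((-Q).prod P) →ₐ[R] CliffordAlgebra Q ⊗[R] CliffordAlgebra P :=
  lift ((-Q).prod P) ⟨LinearMap.coprod
      ((TensorProduct.mk R _ _).flip (ι P a * ι P b) ∘ₗ ι Q)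
      (TensorProduct.mk R _ _ 1 ∘ₗ ι P), by
    rintro ⟨m, u⟩
    simp only [LinearMap.coprod_apply, LinearMap.comp_apply, LinearMap.flip_apply,
      TensorProduct.mk_apply, add_mul, mul_add, Algebra.TensorProduct.tmul_mul_tmul,
      ι_sq_scalar, ι_mul_ι_mul_self_of_isOrtho hab ha hb, ι_mul_ι_mul_ι_anticomm hab hspan,
      one_mul, mul_one, TensorProduct.tmul_neg, QuadraticMap.prod_apply, map_add,
      neg_apply, map_neg,
      Algebra.algebraMap_eq_smul_one, TensorProduct.tmul_smul, TensorProduct.smul_tmul']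
    abel⟩

theorem negProdToTensor_ι (hab : P.IsOrtho a b) (ha : P a = -1) (hb : P b = -1)
    (hspan : Submodule.span R {a, b} = ⊤) (m : M) (u : N) :
    negProdToTensor Q hab ha hb hspan (ι _ (m, u)) =
      ι Q m ⊗ₜ (ι P a * ι P b) + 1 ⊗ₜ ι P u :=
  lift_ι_apply _ _ _

theorem map_inr_comm_ι_inl (m : M) :
    map (.inr (-Q) P) (ι P a * ι P b) * ι ((-Q).prod P) (m, 0) =
      ι ((-Q).prod P) (m, 0) * map (.inr (-Q) P) (ι P a * ι P b) := by
  simp only [map_mul, map_apply_ι, QuadraticMap.Isometry.inr_apply]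
  exact ι_mul_ι_mul_ι_comm_of_isOrtho (.inl_inr _ _) (.inl_inr _ _)

variable (Q) in
/-- The map `Cl(Q) → Cl(-Q ⊕ P)` sending `m` to `-mab`. -/
noncomputable def toNegProd (hab : P.IsOrtho a b) (ha : P a = -1) (hb : P b = -1) :
    CliffordAlgebra Q →ₐ[R] CliffordAlgebra ((-Q).prod P) :=
  lift Q ⟨-(LinearMap.mulRight R (map (.inr (-Q) P) (ι P a * ι P b)) ∘ₗ
      ι ((-Q).prod P) ∘ₗ LinearMap.inl R M N), fun m => by
    simp only [LinearMap.neg_apply, LinearMap.comp_apply, LinearMap.inl_apply,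
      LinearMap.mulRight_apply, neg_mul_neg]
    rw [mul_assoc, ← mul_assoc (map _ _), map_inr_comm_ι_inl, mul_assoc, ← map_mul,
      ι_mul_ι_mul_self_of_isOrtho hab ha hb, ← mul_assoc, ι_sq_scalar]
    simp⟩

theorem toNegProd_ι (hab : P.IsOrtho a b) (ha : P a = -1) (hb : P b = -1) (m : M) :
    toNegProd Q hab ha hb (ι Q m) =
      -(ι ((-Q).prod P) (m, 0) * map (.inr (-Q) P) (ι P a * ι P b)) :=
  lift_ι_apply _ _ _

theorem commute_toNegProd_map_inr (hab : P.IsOrtho a b) (ha : P a = -1) (hb : P b = -1)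
    (hspan : Submodule.span R {a, b} = ⊤) (x : CliffordAlgebra Q) (y : CliffordAlgebra P) :
    Commute (toNegProd Q hab ha hb x) (map (.inr (-Q) P) y) := by
  refine commute_of_commute_ι _ _ (fun m u => ?_) x y
  rw [toNegProd_ι]
  refine Commute.neg_left ?_
  have h : ι ((-Q).prod P) (m, 0) * map (.inr (-Q) P) (ι P u) =
      -(map (.inr (-Q) P) (ι P u) * ι ((-Q).prod P) (m, 0)) := by
    rw [map_apply_ι]
    exact ι_mul_ι_comm_of_isOrtho (.inl_inr _ _)
  rw [commute_iff_eq, mul_assoc, ← map_mul, ι_mul_ι_mul_ι_anticomm hab hspan, map_neg,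
    map_mul _ (ι P u), mul_neg, ← mul_assoc, h, neg_mul, neg_neg, mul_assoc]

/-- If `P` is a form on a plane spanned by orthogonal vectors `a`, `b` of square `-1`, then
`Cl(Q) ⊗ Cl(P) ≃ Cl(-Q ⊕ P)`. -/
noncomputable def tensorEquivNegProd (hab : P.IsOrtho a b) (ha : P a = -1) (hb : P b = -1)
    (hspan : Submodule.span R {a, b} = ⊤) :
    CliffordAlgebra Q ⊗[R] CliffordAlgebra P ≃ₐ[R] CliffordAlgebra ((-Q).prod P) :=
  AlgEquiv.ofAlgHom
    (Algebra.TensorProduct.lift (toNegProd Q hab ha hb) (map (.inr (-Q) P))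
      (commute_toNegProd_map_inr hab ha hb hspan))
    (negProdToTensor Q hab ha hb hspan)
    (by
      apply hom_ext
      ext v
      · simp only [LinearMap.comp_apply, AlgHom.toLinearMap_apply, AlgHom.comp_apply,
          LinearMap.inl_apply, negProdToTensor_ι, map_add, Algebra.TensorProduct.lift_tmul,
          toNegProd_ι, map_zero, mul_zero, add_zero, neg_mul, mul_assoc, ← map_mul]
        rw [← mul_assoc (ι P a), ι_mul_ι_mul_self_of_isOrtho hab ha hb]
        simp
      · simp [negProdToTensor_ι])
    (by
      have hinr (u : N) : negProdToTensor Q hab ha hb hspan (map (.inr (-Q) P) (ι P u)) =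
          1 ⊗ₜ ι P u := by
        simp [negProdToTensor_ι]
      apply Algebra.TensorProduct.ext
      · apply hom_ext
        ext m
        simp only [LinearMap.comp_apply, AlgHom.toLinearMap_apply, AlgHom.comp_apply,
          Algebra.TensorProduct.includeLeft_apply, Algebra.TensorProduct.lift_tmul, map_one,
          mul_one, toNegProd_ι, map_neg, map_mul, hinr]
        simp [negProdToTensor_ι, ι_mul_ι_mul_self_of_isOrtho hab ha hb, TensorProduct.tmul_neg]
      · apply hom_ext
        ext u
        simp [negProdToTensor_ι])

end CliffordAlgebra

/-- The reindexing `(p + q) + 2 → q + (p + 2)` that swaps the first two blocks. -/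
def swapBlocksEquiv (p q r : ℕ) : Fin (p + q) ⊕ Fin (0 + r) ≃ Fin (q + (p + r)) :=
  (Equiv.sumCongr (finSumFinEquiv.symm.trans (Equiv.sumComm _ _))
    (finCongr (Nat.zero_add r))).trans <|
  (Equiv.sumAssoc _ _ _).trans <| (Equiv.sumCongr (Equiv.refl _) finSumFinEquiv).trans
    finSumFinEquiv

/-- The isometry between `-Q_{p,q} ⊕ Q_{0,r}` and `Q_{q,p+r}`. -/
noncomputable def negProdIsometryEquiv (p q r : ℕ) :
    ((-Qpq p q).prod (Qpq 0 r)).IsometryEquiv (Qpq q (p + r)) where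
  toLinearEquiv := (LinearEquiv.sumArrowLequivProdArrow _ _ ℝ ℝ).symm.trans
    (LinearEquiv.funCongrLeft ℝ ℝ (swapBlocksEquiv p q r).symm)
  map_app' := by
    rintro ⟨v, u⟩
    have h (w : Fin (q + (p + r)) → ℝ) : Qpq q (p + r) w =
        ∑ i, (if (swapBlocksEquiv p q r i : ℕ) < q then (1 : ℝ) else -1) *
          (w (swapBlocksEquiv p q r i) * w (swapBlocksEquiv p q r i)) := by
      rw [Qpq, QuadraticMap.weightedSumSquares_apply, ← (swapBlocksEquiv p q r).sum_comp]
      rfl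
    refine (h _).trans ?_
    simp only [Fintype.sum_sum_type, QuadraticMap.prod_apply, neg_apply]
    simp [Qpq, QuadraticMap.weightedSumSquares_apply, swapBlocksEquiv, Fin.sum_univ_add]
    exact add_comm _ _

/-- `Cl(p,q) ⊗_ℝ Cl(0,2) ≅ Cl(q, p+2)` as ℝ-algebras. -/
theorem clifford_tensor_cl02 (p q : ℕ) :
    Nonempty ((Cl p q ⊗[ℝ] Cl 0 2) ≃ₐ[ℝ] Cl q (p + 2)) := by
  have hab : (Qpq 0 2).IsOrtho ![1, 0] ![0, 1] := by
    rw [QuadraticMap.isOrtho_def]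
    simp [Qpq, QuadraticMap.weightedSumSquares_apply, Fin.sum_univ_succ]
  have ha : Qpq 0 2 ![1, 0] = -1 := by
    simp [Qpq, QuadraticMap.weightedSumSquares_apply]
  have hb : Qpq 0 2 ![0, 1] = -1 := by
    simp [Qpq, QuadraticMap.weightedSumSquares_apply]
  have hspan : Submodule.span ℝ {![(1 : ℝ), 0], ![0, 1]} = ⊤ := by
    rw [eq_top_iff]
    intro u _
    refine Submodule.mem_span_pair.2 ⟨u 0, u 1, ?_⟩
    ext i
    fin_cases i <;> simp
  exact ⟨(CliffordAlgebra.tensorEquivNegProd (Q := Qpq p q) hab ha hb hspan).trans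
    (CliffordAlgebra.equivOfIsometry (negProdIsometryEquiv p q 2))⟩
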